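/- arXiv:math/0503247 — 5 statements merged into one kernel-verified Lean document; each statement's English description precedes it below -/
import Mathlib

section
/- Let f : Y → X be a continuous map of topological spaces that admits local sections. If Y is a locally connected space, then X is a locally connected space. -/
/-- A continuous map `f : Y → X` admits local sections if for every `x ∈ X` there exist an
open set `U ⊆ X` containing `x` and a continuous map `s : U → Y` with `f (s u) = u` for all
`u ∈ U`. -/
def AdmitsLocalSections {Y X : Type*} [TopologicalSpace Y] [TopologicalSpace X]
    (f : Y → X) : Prop :=
  ∀ x : X, ∃ U : Set X, IsOpen U ∧ x ∈ U ∧ ∃ s : C(U, Y), ∀ u : U, f (s u) = (u : X)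

/-- If `f : Y → X` is a continuous map admitting local sections and `Y` is locally connected,
then `X` is locally connected. -/
theorem locallyConnectedSpace_of_admitsLocalSections {Y X : Type*} [TopologicalSpace Y]
    [TopologicalSpace X] (f : Y → X) (hf : Continuous f) (hs : AdmitsLocalSections f)
    [LocallyConnectedSpace Y] : LocallyConnectedSpace X := by
  refine locallyConnectedSpace_iff_connected_subsets.2 fun x N hN ↦ ?_
  obtain ⟨U, hU, hxU, s, hfs⟩ := hs x
  set y := s ⟨x, hxU⟩
  have hy : f y = x := hfs ⟨x, hxU⟩
  obtain ⟨W, hW, hWc, hWN⟩ := locallyConnectedSpace_iff_connected_subsets.1 ‹_› y (f ⁻¹' N)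
    (hf.continuousAt.preimage_mem_nhds (hy.symm ▸ hN))
  refine ⟨f '' W, ?_, hWc.image f hf.continuousOn, Set.image_subset_iff.2 hWN⟩
  have hsW : s ⁻¹' W ∈ nhds (⟨x, hxU⟩ : U) := s.continuous.continuousAt.preimage_mem_nhds hW
  refine Filter.mem_of_superset (hU.isOpenMap_subtype_val.image_mem_nhds hsW) ?_
  rintro _ ⟨u, hu, rfl⟩
  exact ⟨s u, hu, hfs u⟩
end

section
/- Let i : A → B and f : X → Y be continuous maps of topological spaces, and let (U_j), j ∈ J, be a family of open subsets of B whose union contains the image i(A). If for every j the restriction i⁻¹(U_j) → U_j of i (with the subspace topologies) has the local left lifting property with respect to f, then i has the local left lifting property with respect to f. -/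
/-- `i : A → B` has the local left lifting property with respect to `f : X → Y` if for all
continuous `u : A → X` and `v : B → Y` with `f ∘ u = v ∘ i` and every `a ∈ A`, there exist an
open set `U ⊆ B` containing `i a` and a continuous map `ℓ : U → X` such that `f (ℓ b) = v b`
for all `b ∈ U` and `ℓ (i a') = u a'` for all `a' ∈ A` with `i a' ∈ U`. -/
def HasLocalLeftLifting {A B X Y : Type*} [TopologicalSpace A] [TopologicalSpace B]
    [TopologicalSpace X] [TopologicalSpace Y] (i : C(A, B)) (f : C(X, Y)) : Prop :=
  ∀ (u : C(A, X)) (v : C(B, Y)), (∀ a : A, f (u a) = v (i a)) →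
    ∀ a : A, ∃ U : Set B, IsOpen U ∧ i a ∈ U ∧
      ∃ ℓ : C(U, X), (∀ b : U, f (ℓ b) = v (b : B)) ∧
        ∀ (a' : A) (h : i a' ∈ U), ℓ ⟨i a', h⟩ = u a'

/-- If `(U j)` is a family of open subsets of `B` whose union contains `i(A)` and every
restriction `i⁻¹(U j) → U j` of `i` has the local left lifting property with respect to `f`,
then `i` has the local left lifting property with respect to `f`. -/
theorem hasLocalLeftLifting_of_locally {A B X Y : Type*} [TopologicalSpace A]
    [TopologicalSpace B] [TopologicalSpace X] [TopologicalSpace Y] (i : C(A, B)) (f : C(X, Y))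
    {J : Type*} (U : J → Set B) (hUopen : ∀ j, IsOpen (U j))
    (hUcov : ∀ a : A, ∃ j, i a ∈ U j)
    (h : ∀ j, HasLocalLeftLifting
        (⟨(U j).restrictPreimage ⇑i, i.continuous.restrictPreimage⟩ :
          C((⇑i ⁻¹' U j), (U j))) f) :
    HasLocalLeftLifting i f := by
  intro u v huv a
  obtain ⟨j, hj⟩ := hUcov a
  obtain ⟨V, hVopen, haV, ℓ, hℓf, hℓu⟩ :=
    h j (u.restrict (i ⁻¹' U j)) (v.restrict (U j)) (fun a' => huv a') ⟨a, hj⟩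
  have mem_U : ∀ b : (Subtype.val '' V : Set B), (b : B) ∈ U j := by
    rintro ⟨_, b, _, rfl⟩
    exact b.2
  have mem_V : ∀ b : (Subtype.val '' V : Set B), (⟨b, mem_U b⟩ : U j) ∈ V := by
    rintro ⟨_, b, hb, rfl⟩
    exact hb
  refine ⟨Subtype.val '' V, (hUopen j).isOpenMap_subtype_val V hVopen, ⟨_, haV, rfl⟩,
    ℓ.comp ⟨fun b => ⟨⟨b, mem_U b⟩, mem_V b⟩, by fun_prop⟩, fun b => hℓf _, fun a' ha' => ?_⟩
  exact hℓu ⟨a', mem_U ⟨i a', ha'⟩⟩ (mem_V ⟨i a', ha'⟩)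
end

section
/- Let i : A → B and f : X → Y be continuous maps of topological spaces, let p : B' → B be a continuous map that admits local sections, let A' = {(b', a) ∈ B' × A : p(b') = i(a)} with the subspace topology of B' × A, and let i' : A' → B' be the first projection. If i' has the local left lifting property with respect to f, then i has the local left lifting property with respect to f. -/
/-- If `p : B' → B` admits local sections and the pullback
`i' : A' = B' ×_B A → B'` of `i` along `p` has the local left lifting property with respect
to `f`, then so does `i`. -/
theorem hasLocalLeftLifting_of_pullback {A B B' X Y : Type*} [TopologicalSpace A]
    [TopologicalSpace B] [TopologicalSpace B'] [TopologicalSpace X] [TopologicalSpace Y]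
    (i : C(A, B)) (f : C(X, Y)) (p : C(B', B)) (hp : AdmitsLocalSections ⇑p)
    (h : HasLocalLeftLifting
        (⟨fun q : {q : B' × A // p q.1 = i q.2} => q.1.1,
          continuous_subtype_val.fst⟩ : C({q : B' × A // p q.1 = i q.2}, B')) f) :
    HasLocalLeftLifting i f := by
  intro u v huv a
  obtain ⟨V, hV, haV, s, hs⟩ := hp (i a)
  obtain ⟨U', hU', haU', l, hl, hlu⟩ :=
    h (u.comp ⟨fun q => q.1.2, continuous_subtype_val.snd⟩) (v.comp p)
      (fun q => (huv q.1.2).trans (congrArg v q.2.symm)) ⟨(s ⟨i a, haV⟩, a), hs _⟩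
  let U : Set B := {b | ∃ hb : b ∈ V, s ⟨b, hb⟩ ∈ U'}
  have hU : U = Subtype.val '' (s ⁻¹' U') := by
    ext b
    simp [U]
  have hsU : Continuous fun b : U => s ⟨b.1, b.2.1⟩ :=
    s.continuous.comp (continuous_subtype_val.subtype_mk _)
  refine ⟨U, hU ▸ hV.isOpenMap_subtype_val _ (hU'.preimage s.continuous), ⟨haV, haU'⟩,
    l.comp ⟨fun b => ⟨s ⟨b.1, b.2.1⟩, b.2.2⟩, hsU.subtype_mk _⟩, fun b => ?_, fun a' ha' => ?_⟩
  · exact (hl _).trans (congrArg v (hs _))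
  · exact hlu ⟨(s ⟨i a', ha'.1⟩, a'), hs _⟩ ha'.2
end

section
/- Let f : X → Y be a locally cartesian map of topological spaces, and let i : A → B be a continuous embedding that is a local retract: for every a ∈ A there exist an open set W ⊆ B containing i(a) and a continuous map r : W → A with r(i(a')) = a' for all a' ∈ A with i(a') ∈ W. Then i has the local left lifting property with respect to f. -/
universe u

/-- A continuous map `f : X → Y` is locally cartesian if every `x ∈ X` has an open
neighborhood `U` mapping into an open neighborhood `V` of `f x` such that `U` is homeomorphic
to a product `Z × V` over `V`. -/
def IsLocallyCartesian {X Y : Type u} [TopologicalSpace X] [TopologicalSpace Y]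
    (f : X → Y) : Prop :=
  ∀ x : X, ∃ (U : Set X) (V : Set Y), IsOpen U ∧ x ∈ U ∧ IsOpen V ∧ f x ∈ V ∧ f '' U ⊆ V ∧
    ∃ (Z : Type u) (_ : TopologicalSpace Z) (φ : U ≃ₜ Z × V), ∀ u : U, ((φ u).2 : Y) = f u

/-- If `f` is locally cartesian and `i` is an embedding that is a local retract, then `i`
has the local left lifting property with respect to `f`. -/
theorem hasLocalLeftLifting_of_isLocallyCartesian {A B : Type*} {X Y : Type u}
    [TopologicalSpace A] [TopologicalSpace B] [TopologicalSpace X] [TopologicalSpace Y]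
    (i : C(A, B)) (hemb : Topology.IsEmbedding ⇑i)
    (hret : ∀ a : A, ∃ W : Set B, IsOpen W ∧ i a ∈ W ∧
      ∃ r : C(W, A), ∀ (a' : A) (h : i a' ∈ W), r ⟨i a', h⟩ = a')
    (f : C(X, Y)) (hf : IsLocallyCartesian ⇑f) :
    HasLocalLeftLifting i f := by
  intro u v huv a
  obtain ⟨U, V, hU, haU, hV, haV, -, Z, _, φ, hφ⟩ := hf (u a)
  obtain ⟨W, hW, haW, r, hr⟩ := hret a
  let O : Set W := {w | u (r w) ∈ U ∧ v w ∈ V}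
  have hO : IsOpen O :=
    (hU.preimage (u.continuous.comp r.continuous)).inter
      (hV.preimage (v.continuous.comp continuous_subtype_val))
  have mem_O (b : Subtype.val '' O) : ∃ h : (b : B) ∈ W, (⟨b, h⟩ : W) ∈ O := by
    obtain ⟨_, w, hw, rfl⟩ := b
    exact ⟨w.2, hw⟩
  choose hbW hbO using mem_O
  refine ⟨Subtype.val '' O, hW.isOpenMap_subtype_val _ hO, ⟨⟨i a, haW⟩, ⟨?_, ?_⟩, rfl⟩, ?_⟩
  · rwa [hr]
  · rwa [← huv]
  let s : C(Subtype.val '' O, U) :=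
    ⟨fun b => ⟨u (r ⟨b, hbW b⟩), (hbO b).1⟩, by fun_prop⟩
  let t : C(Subtype.val '' O, V) := ⟨fun b => ⟨v b, (hbO b).2⟩, by fun_prop⟩
  refine ⟨⟨fun b => (φ.symm ((φ (s b)).1, t b) : X), by fun_prop⟩, fun b => ?_,
    fun a' h => ?_⟩
  · simp only [ContinuousMap.coe_mk]
    rw [← hφ, φ.apply_symm_apply]
    rfl
  · have hs : (s ⟨i a', h⟩ : X) = u a' := congrArg u (hr a' _)
    have ht : t ⟨i a', h⟩ = (φ (s ⟨i a', h⟩)).2 :=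
      Subtype.ext (by rw [hφ, hs, huv]; rfl)
    simp only [ContinuousMap.coe_mk]
    rw [ht, Prod.mk.eta, φ.symm_apply_apply, hs]
end

section
/- Let H, K, D be groups and φ : H → D, ψ : K → D group homomorphisms. Let Y and Z be topological spaces equipped with properly discontinuous actions of H and of K, respectively, each by homeomorphisms. Let X be a topological space with an action of D, and let F : Y → X and G : Z → X be continuous maps satisfying F(h • y) = φ(h) • F(y) for all h ∈ H, y ∈ Y, and G(k • z) = ψ(k) • G(z) for all k ∈ K, z ∈ Z. Give D the discrete topology and let P = {(y, z, d) ∈ Y × Z × D : d • F(y) = G(z)} with the subspace topology of the product Y × Z × D. Then the formula (h, k) • (y, z, d) = (h • y, k • z, ψ(k) · d · φ(h)⁻¹) defines an action of H × K on P by homeomorphisms, and this action is properly discontinuous. -/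
open Pointwise
variable {H K D Y Z X : Type*}

/-- A set `S` as "`G`-invariant" means `g • S = S` for all `g`.  An action of a group `G` by
homeomorphisms on a topological space `W` is properly discontinuous if for every `w ∈ W`,
writing `I_w` for the stabilizer of `w`, there is an `I_w`-invariant open neighborhood `U` of
`w` such that (1) the induced action of `I_w` on `U` is mild at `w` (every open neighborhood
of `w` inside `U` contains an `I_w`-invariant open neighborhood of `w`), and
(2) `U ∩ g • U = ∅` for every `g ∉ I_w`. -/
def IsProperlyDiscontinuous (G W : Type*) [Group G] [TopologicalSpace W]
    [MulAction G W] : Prop :=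
  ∀ w : W, ∃ U : Set W, IsOpen U ∧ w ∈ U ∧
    (∀ g ∈ MulAction.stabilizer G w, g • U = U) ∧
    (∀ V : Set W, IsOpen V → w ∈ V → V ⊆ U →
      ∃ U' : Set W, IsOpen U' ∧ w ∈ U' ∧ U' ⊆ V ∧
        ∀ g ∈ MulAction.stabilizer G w, g • U' = U') ∧
    ∀ g : G, g ∉ MulAction.stabilizer G w → U ∩ g • U = ∅

/-- The action of an element of `H × K` on the coupled space
`P = {(y, z, d) : d • F y = G z}`, given by
`(h, k) • (y, z, d) = (h • y, k • z, ψ k * d * (φ h)⁻¹)`. -/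
def coupledSMul [Group H] [Group K] [Group D] [MulAction H Y] [MulAction K Z] [MulAction D X]
    (φ : H →* D) (ψ : K →* D) (F : Y → X) (G : Z → X)
    (hF : ∀ (h : H) (y : Y), F (h • y) = φ h • F y)
    (hG : ∀ (k : K) (z : Z), G (k • z) = ψ k • G z)
    (hk : H × K) (q : {q : Y × Z × D // q.2.2 • F q.1 = G q.2.1}) :
    {q : Y × Z × D // q.2.2 • F q.1 = G q.2.1} :=
  ⟨(hk.1 • q.1.1, hk.2 • q.1.2.1, ψ hk.2 * q.1.2.2 * (φ hk.1)⁻¹), by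
    have hq : q.1.2.2 • F q.1.1 = G q.1.2.1 := q.2
    show (ψ hk.2 * q.1.2.2 * (φ hk.1)⁻¹) • F (hk.1 • q.1.1) = G (hk.2 • q.1.2.1)
    rw [hF, hG, smul_smul, inv_mul_cancel_right, ← smul_smul, hq]⟩

/-- The formula `(h, k) • (y, z, d) = (h • y, k • z, ψ k * d * (φ h)⁻¹)` defines an action of
`H × K` on `P = {(y, z, d) : d • F y = G z}`. -/
def coupledAction [Group H] [Group K] [Group D] [MulAction H Y] [MulAction K Z] [MulAction D X]
    (φ : H →* D) (ψ : K →* D) (F : Y → X) (G : Z → X)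
    (hF : ∀ (h : H) (y : Y), F (h • y) = φ h • F y)
    (hG : ∀ (k : K) (z : Z), G (k • z) = ψ k • G z) :
    MulAction (H × K) {q : Y × Z × D // q.2.2 • F q.1 = G q.2.1} where
  smul := coupledSMul φ ψ F G hF hG
  one_smul q := Subtype.ext <| by
    show (((1 : H) • q.1.1, (1 : K) • q.1.2.1, ψ 1 * q.1.2.2 * (φ 1)⁻¹) : Y × Z × D) = q.1
    simp
  mul_smul a b q := Subtype.ext <| by
    show (((a.1 * b.1) • q.1.1, (a.2 * b.2) • q.1.2.1,
        ψ (a.2 * b.2) * q.1.2.2 * (φ (a.1 * b.1))⁻¹) : Y × Z × D) =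
      (a.1 • b.1 • q.1.1, a.2 • b.2 • q.1.2.1,
        ψ a.2 * (ψ b.2 * q.1.2.2 * (φ b.1)⁻¹) * (φ a.1)⁻¹)
    simp [mul_smul, map_mul, mul_inv_rev, mul_assoc]

section CoupledSpace

variable [Group H] [Group K] [Group D] [MulAction H Y] [MulAction K Z] [MulAction D X]

theorem continuous_coupledSMul [TopologicalSpace Y] [TopologicalSpace Z]
    [TopologicalSpace D] [DiscreteTopology D]
    [ContinuousConstSMul H Y] [ContinuousConstSMul K Z]
    (φ : H →* D) (ψ : K →* D) (F : Y → X) (G : Z → X)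
    (hF : ∀ (h : H) (y : Y), F (h • y) = φ h • F y)
    (hG : ∀ (k : K) (z : Z), G (k • z) = ψ k • G z) (hk : H × K) :
    Continuous (coupledSMul φ ψ F G hF hG hk) := by
  refine Continuous.subtype_mk (.prodMk ?_ (.prodMk ?_ ?_)) _
  · fun_prop
  · fun_prop
  · exact (continuous_of_discreteTopology (f := fun d : D => ψ hk.2 * d * (φ hk.1)⁻¹)).comp
      (by fun_prop : Continuous fun q : {q : Y × Z × D // q.2.2 • F q.1 = G q.2.1} => q.1.2.2)

/-- The part of the coupled space lying over `A ⊆ Y`, `B ⊆ Z` and `d : D`. -/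
def coupledBox (F : Y → X) (G : Z → X) (A : Set Y) (B : Set Z) (d : D) :
    Set {q : Y × Z × D // q.2.2 • F q.1 = G q.2.1} :=
  {q | q.1.1 ∈ A ∧ q.1.2.1 ∈ B ∧ q.1.2.2 = d}

theorem isOpen_coupledBox [TopologicalSpace Y] [TopologicalSpace Z]
    [TopologicalSpace D] [DiscreteTopology D] {F : Y → X} {G : Z → X} {A : Set Y} {B : Set Z}
    (hA : IsOpen A) (hB : IsOpen B) (d : D) : IsOpen (coupledBox F G A B d) :=
  (hA.prod (hB.prod (isOpen_discrete {d}))).preimage continuous_subtype_val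

theorem exists_coupledBox_subset [TopologicalSpace Y] [TopologicalSpace Z]
    [TopologicalSpace D] {F : Y → X} {G : Z → X}
    {V : Set {q : Y × Z × D // q.2.2 • F q.1 = G q.2.1}} (hV : IsOpen V)
    {w : {q : Y × Z × D // q.2.2 • F q.1 = G q.2.1}} (hw : w ∈ V) :
    ∃ A : Set Y, ∃ B : Set Z, IsOpen A ∧ IsOpen B ∧ w.1.1 ∈ A ∧ w.1.2.1 ∈ B ∧
      coupledBox F G A B w.1.2.2 ⊆ V := by
  obtain ⟨O, hO, rfl⟩ := isOpen_induced_iff.1 hV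
  obtain ⟨A, O', hA, hO', hwA, hwO', hsub⟩ := isOpen_prod_iff.1 hO w.1.1 w.1.2 hw
  obtain ⟨B, C, hB, -, hwB, hwC, hsub'⟩ := isOpen_prod_iff.1 hO' w.1.2.1 w.1.2.2 hwO'
  refine ⟨A, B, hA, hB, hwA, hwB, fun q hq => hsub ⟨hq.1, hsub' ⟨hq.2.1, ?_⟩⟩⟩
  rw [hq.2.2]
  exact hwC

theorem smul_set_eq_of_forall_smul_mem {M α : Type*} [Group M] [MulAction M α] {S : Subgroup M}
    {s : Set α} (hs : ∀ g ∈ S, ∀ a ∈ s, g • a ∈ s) {g : M} (hg : g ∈ S) : g • s = s := by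
  refine (Set.smul_set_subset_iff.2 fun a ha => hs g hg a ha).antisymm fun a ha => ?_
  exact Set.mem_smul_set_iff_inv_smul_mem.2 (hs _ (S.inv_mem hg) a ha)

theorem mem_stabilizer_coupledAction_iff (φ : H →* D) (ψ : K →* D) (F : Y → X) (G : Z → X)
    (hF : ∀ (h : H) (y : Y), F (h • y) = φ h • F y)
    (hG : ∀ (k : K) (z : Z), G (k • z) = ψ k • G z)
    (w : {q : Y × Z × D // q.2.2 • F q.1 = G q.2.1}) (g : H × K) :
    letI := coupledAction φ ψ F G hF hG
    g ∈ MulAction.stabilizer (H × K) w ↔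
      g.1 ∈ MulAction.stabilizer H w.1.1 ∧ g.2 ∈ MulAction.stabilizer K w.1.2.1 ∧
        ψ g.2 * w.1.2.2 * (φ g.1)⁻¹ = w.1.2.2 := by
  let := coupledAction φ ψ F G hF hG
  simp only [MulAction.mem_stabilizer_iff]
  exact Subtype.ext_iff.trans (Prod.ext_iff.trans (and_congr_right' Prod.ext_iff))

theorem smul_coupledBox_eq (φ : H →* D) (ψ : K →* D) (F : Y → X) (G : Z → X)
    (hF : ∀ (h : H) (y : Y), F (h • y) = φ h • F y)
    (hG : ∀ (k : K) (z : Z), G (k • z) = ψ k • G z)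
    (w : {q : Y × Z × D // q.2.2 • F q.1 = G q.2.1}) {A : Set Y} {B : Set Z}
    (hA : ∀ h ∈ MulAction.stabilizer H w.1.1, h • A = A)
    (hB : ∀ k ∈ MulAction.stabilizer K w.1.2.1, k • B = B) :
    letI := coupledAction φ ψ F G hF hG
    ∀ g ∈ MulAction.stabilizer (H × K) w,
      g • coupledBox F G A B w.1.2.2 = coupledBox F G A B w.1.2.2 := by
  let := coupledAction φ ψ F G hF hG
  intro g hg
  refine smul_set_eq_of_forall_smul_mem (fun g hg q hq => ?_) hg
  obtain ⟨h₁, h₂, h₃⟩ := (mem_stabilizer_coupledAction_iff φ ψ F G hF hG w g).1 hg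
  refine ⟨hA _ h₁ ▸ Set.smul_mem_smul_set hq.1, hB _ h₂ ▸ Set.smul_mem_smul_set hq.2.1, ?_⟩
  change ψ g.2 * q.1.2.2 * (φ g.1)⁻¹ = w.1.2.2
  rw [hq.2.2, h₃]

end CoupledSpace

/-- Given properly discontinuous actions of `H` on `Y` and of `K` on `Z` by homeomorphisms,
a group `D` with the discrete topology acting on a space `X`, and continuous equivariant maps
`F : Y → X` and `G : Z → X`, the action of `H × K` on
`P = {(y, z, d) ∈ Y × Z × D : d • F y = G z}` given by
`(h, k) • (y, z, d) = (h • y, k • z, ψ k * d * (φ h)⁻¹)` is an action by homeomorphisms and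
is properly discontinuous. -/
theorem coupledAction_isProperlyDiscontinuous
    [Group H] [Group K] [Group D] [MulAction H Y] [MulAction K Z] [MulAction D X]
    [TopologicalSpace Y] [TopologicalSpace Z] [TopologicalSpace X]
    [TopologicalSpace D] [DiscreteTopology D]
    [ContinuousConstSMul H Y] [ContinuousConstSMul K Z]
    (hYpd : IsProperlyDiscontinuous H Y) (hZpd : IsProperlyDiscontinuous K Z)
    (φ : H →* D) (ψ : K →* D) (F : Y → X) (G : Z → X)
    (hFc : Continuous F) (hGc : Continuous G)
    (hF : ∀ (h : H) (y : Y), F (h • y) = φ h • F y)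
    (hG : ∀ (k : K) (z : Z), G (k • z) = ψ k • G z) :
    (∀ hk : H × K, IsHomeomorph (coupledSMul φ ψ F G hF hG hk)) ∧
      @IsProperlyDiscontinuous (H × K) {q : Y × Z × D // q.2.2 • F q.1 = G q.2.1} _ _
        (coupledAction φ ψ F G hF hG) := by
  let := coupledAction φ ψ F G hF hG
  have : ContinuousConstSMul (H × K) {q : Y × Z × D // q.2.2 • F q.1 = G q.2.1} :=
    ⟨continuous_coupledSMul φ ψ F G hF hG⟩
  refine ⟨fun hk => (Homeomorph.smul hk).isHomeomorph, fun w => ?_⟩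
  obtain ⟨U, hU, hwU, hUinv, hUmild, hUdisj⟩ := hYpd w.1.1
  obtain ⟨V, hV, hwV, hVinv, hVmild, hVdisj⟩ := hZpd w.1.2.1
  refine ⟨coupledBox F G U V w.1.2.2, isOpen_coupledBox hU hV _, ⟨hwU, hwV, rfl⟩,
    smul_coupledBox_eq φ ψ F G hF hG w hUinv hVinv, fun O hO hwO _ => ?_, fun g hg => ?_⟩
  · obtain ⟨A, B, hA, hB, hwA, hwB, hAB⟩ := exists_coupledBox_subset hO hwO
    obtain ⟨A', hA', hwA', hA'A, hA'inv⟩ :=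
      hUmild (A ∩ U) (hA.inter hU) ⟨hwA, hwU⟩ Set.inter_subset_right
    obtain ⟨B', hB', hwB', hB'B, hB'inv⟩ :=
      hVmild (B ∩ V) (hB.inter hV) ⟨hwB, hwV⟩ Set.inter_subset_right
    exact ⟨coupledBox F G A' B' w.1.2.2, isOpen_coupledBox hA' hB' _, ⟨hwA', hwB', rfl⟩,
      fun q hq => hAB ⟨(hA'A hq.1).1, (hB'B hq.2.1).1, hq.2.2⟩,
      smul_coupledBox_eq φ ψ F G hF hG w hA'inv hB'inv⟩
  · refine Set.eq_empty_of_forall_notMem ?_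
    rintro _ ⟨hgq, q, hq, rfl⟩
    refine hg ((mem_stabilizer_coupledAction_iff φ ψ F G hF hG w g).2 ⟨?_, ?_, ?_⟩)
    · by_contra h
      exact (hUdisj g.1 h).le ⟨hgq.1, Set.smul_mem_smul_set hq.1⟩
    · by_contra h
      exact (hVdisj g.2 h).le ⟨hgq.2.1, Set.smul_mem_smul_set hq.2.1⟩
    · have hd : ψ g.2 * q.1.2.2 * (φ g.1)⁻¹ = w.1.2.2 := hgq.2.2
      rwa [hq.2.2] at hd
end
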